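/- Let G be a finite simple graph, let 0 < ε < 1, and set k = ⌈1/ε⌉. Define a sequence of edge sets as follows: M₀ = ∅, and for each i = 0, 1, …, k, let P_{i+1} be the set of all M_i-augmenting paths of length 2i+1, let P*_{i+1} be any maximal (with respect to set inclusion) collection of pairwise vertex-disjoint paths from P_{i+1}, and set M_{i+1} = M_i ⊕ E(P*_{i+1}). Then M_{k+1} is a matching in G and |M_{k+1}| ≥ (1 − ε)·|M*|, where M* is a maximum cardinality matching of G. -/

import Mathlib

/-- `M` is a matching in `G`: a set of edges of `G`, no two of which share an endpoint. -/
def IsEdgeMatching {V : Type*} (G : SimpleGraph V) (M : Set (Sym2 V)) : Prop :=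
  M ⊆ G.edgeSet ∧ ∀ e ∈ M, ∀ f ∈ M, e ≠ f → ∀ x : V, ¬(x ∈ e ∧ x ∈ f)

/-- A walk `p` from `u` to `v` is an `M`-augmenting path: it is a path with distinct
endpoints, its edges alternate between edges of `M` and edges not in `M`, and both of
its endpoints are `M`-free. -/
def IsAugPath {V : Type*} {G : SimpleGraph V} (M : Set (Sym2 V)) {u v : V}
    (p : G.Walk u v) : Prop :=
  p.IsPath ∧ u ≠ v ∧
    List.Chain' (fun e f => ¬(e ∈ M ↔ f ∈ M)) p.edges ∧
    (∀ e ∈ M, u ∉ e) ∧ (∀ e ∈ M, v ∉ e)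

/-- A walk in `G` bundled together with its endpoints. -/
abbrev PathSig {V : Type*} (G : SimpleGraph V) := Σ u : V, Σ v : V, G.Walk u v

/-- Two bundled walks are vertex-disjoint: they share no vertex. -/
def VDisj {V : Type*} {G : SimpleGraph V} (p q : PathSig G) : Prop :=
  ∀ x : V, x ∈ p.2.2.support → x ∉ q.2.2.support

/-- The set of edges appearing in a collection of bundled walks. -/
def pathsEdges {V : Type*} {G : SimpleGraph V} (P : Set (PathSig G)) : Set (Sym2 V) :=
  {e | ∃ p ∈ P, e ∈ p.2.2.edges}

/-- `M` leaves the vertex `v` uncovered. -/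
def EdgeFree {V : Type*} (M : Set (Sym2 V)) (v : V) : Prop := ∀ e ∈ M, v ∉ e

/-- The edges of the walk lie alternately in `A` and in `B`, starting with `A`. -/
def AltWalk {V : Type*} {G : SimpleGraph V} :
    Set (Sym2 V) → Set (Sym2 V) → ∀ {u v : V}, G.Walk u v → Prop
  | _, _, _, _, .nil => True
  | A, B, u, _, .cons (v := w) _ p => s(u, w) ∈ A ∧ AltWalk B A p

section

variable {V : Type*} {G : SimpleGraph V}

theorem AltWalk.mono_on : ∀ {A B A' B' : Set (Sym2 V)} {u v : V} {p : G.Walk u v},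
    AltWalk A B p → (∀ e ∈ p.edges, e ∈ A → e ∈ A') → (∀ e ∈ p.edges, e ∈ B → e ∈ B') →
    AltWalk A' B' p
  | _, _, _, _, _, _, .nil, _, _, _ => trivial
  | _, _, _, _, _, _, .cons _ _, hp, hA, hB =>
    ⟨hA _ (by simp) hp.1, hp.2.mono_on (fun e he => hB e (by simp [he]))
      (fun e he => hA e (by simp [he]))⟩

theorem AltWalk.mono {A B A' B' : Set (Sym2 V)} {u v : V} {p : G.Walk u v}
    (hp : AltWalk A B p) (hA : A ⊆ A') (hB : B ⊆ B') : AltWalk A' B' p :=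
  hp.mono_on (fun _ _ h => hA h) (fun _ _ h => hB h)

theorem AltWalk.exists_mem_of_mem_support {A B : Set (Sym2 V)} : ∀ {u v : V} {p : G.Walk u v},
    AltWalk A B p → ∀ x ∈ p.support,
      (x = v ∧ Even p.length) ∨ ∃ e ∈ p.edges, e ∈ A ∧ x ∈ e
  | _, _, .nil, _, x, hx => by left; simpa using hx
  | u, v, .cons h .nil, hp, x, hx => by
    right
    refine ⟨s(u, v), by simp, hp.1, by simpa using hx⟩
  | u, v, .cons (v := w) h (.cons h' p), hp, x, hx => by
    simp only [SimpleGraph.Walk.support_cons, List.mem_cons] at hx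
    rcases hx with rfl | rfl | hx
    · exact Or.inr ⟨s(x, w), by simp, hp.1, by simp⟩
    · exact Or.inr ⟨s(u, x), by simp, hp.1, by simp⟩
    · rcases AltWalk.exists_mem_of_mem_support hp.2.2 x hx with ⟨rfl, h⟩ | ⟨e, he, heA, hxe⟩
      · exact Or.inl ⟨rfl, by simpa [Nat.even_add_one] using h⟩
      · exact Or.inr ⟨e, by simp [he], heA, hxe⟩

theorem AltWalk.exists_mem_end {A B : Set (Sym2 V)} : ∀ {u v : V} {p : G.Walk u v},
    AltWalk A B p → Even p.length → u ≠ v → ∃ e ∈ B, v ∈ e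
  | _, _, .nil, _, _, h => (h rfl).elim
  | _, _, .cons h .nil, _, he, _ => by simp at he
  | u, v, .cons (v := w) h (.cons (v := x) h' p), hp, he, _ => by
    by_cases hxv : x = v
    · subst hxv
      exact ⟨s(w, x), hp.2.1, by simp⟩
    · exact AltWalk.exists_mem_end hp.2.2 (by simpa [Nat.even_add_one] using he) hxv

theorem AltWalk.ncard_inter {M : Set (Sym2 V)} : ∀ {u v : V} {p : G.Walk u v},
    AltWalk Mᶜ M p → p.IsPath → (M ∩ {e | e ∈ p.edges}).ncard = p.length / 2
  | _, _, .nil, _, _ => by simp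
  | u, v, .cons h .nil, hp, _ => by
    have h1 : s(u, v) ∉ M := hp.1
    have : M ∩ {e | e ∈ (SimpleGraph.Walk.cons h .nil : G.Walk u v).edges} = ∅ := by
      ext e
      simp only [SimpleGraph.Walk.edges_cons, SimpleGraph.Walk.edges_nil, Set.mem_inter_iff,
        Set.mem_ofPred_eq, List.mem_singleton, Set.mem_empty_iff_false]
      grind
    rw [this]
    simp
  | u, v, .cons (v := w) h (.cons (v := x) h' p), hp, hpath => by
    have h1 : s(u, w) ∉ M := hp.1
    have h2 : s(w, x) ∈ M := hp.2.1
    have ih := AltWalk.ncard_inter hp.2.2 hpath.of_cons.of_cons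
    have hw : w ∉ p.support := (SimpleGraph.Walk.cons_isPath_iff _ _).1 hpath.of_cons |>.2
    have h3 : s(w, x) ∉ p.edges := fun hc => hw (p.fst_mem_support_of_mem_edges hc)
    have : M ∩ {e | e ∈ (SimpleGraph.Walk.cons h (.cons h' p)).edges} =
        insert s(w, x) (M ∩ {e | e ∈ p.edges}) := by
      ext e
      simp only [SimpleGraph.Walk.edges_cons, Set.mem_inter_iff,
        Set.mem_ofPred_eq, List.mem_cons, Set.mem_insert_iff]
      grind
    have hfin : (M ∩ {e | e ∈ p.edges}).Finite :=
      (List.finite_toSet p.edges).subset Set.inter_subset_right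
    rw [this, Set.ncard_insert_of_notMem (by simp [h3]) hfin, ih]
    simp only [SimpleGraph.Walk.length_cons]
    omega

theorem altWalk_of_isChain {M : Set (Sym2 V)} : ∀ {u v : V} {p : G.Walk u v},
    p.edges.IsChain (fun e f => ¬(e ∈ M ↔ f ∈ M)) →
      ((∀ e ∈ p.edges.head?, e ∉ M) → AltWalk Mᶜ M p) ∧
      ((∀ e ∈ p.edges.head?, e ∈ M) → AltWalk M Mᶜ p)
  | _, _, .nil, _ => ⟨fun _ => trivial, fun _ => trivial⟩
  | _, _, .cons h p, hp => by
    rw [SimpleGraph.Walk.edges_cons, List.isChain_cons] at hp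
    have ih := altWalk_of_isChain hp.2
    simp only [SimpleGraph.Walk.edges_cons, List.head?_cons, Option.mem_def, Option.some.injEq,
      forall_eq']
    refine ⟨fun h0 => ⟨h0, ih.2 fun e he => ?_⟩, fun h0 => ⟨h0, ih.1 fun e he => ?_⟩⟩ <;>
    · have := hp.1 e he
      tauto

theorem AltWalk.isChain {A B M : Set (Sym2 V)} : ∀ {u v : V} {p : G.Walk u v},
    AltWalk A B p → (A ⊆ Mᶜ ∧ B ⊆ M ∨ A ⊆ M ∧ B ⊆ Mᶜ) →
      p.edges.IsChain (fun e f => ¬(e ∈ M ↔ f ∈ M))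
  | _, _, .nil, _, _ => by simp
  | _, _, .cons h .nil, _, _ => by simp
  | u, v, .cons (v := w) h (.cons (v := x) h' p), hp, hM => by
    have ih := AltWalk.isChain (M := M) hp.2 (by tauto)
    rw [SimpleGraph.Walk.edges_cons, SimpleGraph.Walk.edges_cons, List.isChain_cons_cons]
    refine ⟨?_, ih⟩
    have h1 := hp.1
    have h2 := hp.2.1
    rcases hM with ⟨ha, hb⟩ | ⟨ha, hb⟩
    · have := ha h1
      have := hb h2
      simp_all
    · have := ha h1
      have := hb h2
      simp_all

theorem IsAugPath.altWalk {M : Set (Sym2 V)} {u v : V} {p : G.Walk u v} (hp : IsAugPath M p) :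
    AltWalk Mᶜ M p := by
  obtain ⟨-, -, hc, hu, -⟩ := hp
  refine (altWalk_of_isChain hc).1 ?_
  cases p with
  | nil => simp
  | cons h q =>
    intro e he heM
    simp only [SimpleGraph.Walk.edges_cons, List.head?_cons, Option.mem_def,
      Option.some.injEq] at he
    exact hu e heM (by simp [← he])

theorem IsAugPath.odd_length {M : Set (Sym2 V)} {u v : V} {p : G.Walk u v}
    (hp : IsAugPath M p) : Odd p.length := by
  rw [← Nat.not_even_iff_odd]
  intro h
  obtain ⟨e, he, hv⟩ := hp.altWalk.exists_mem_end h hp.2.1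
  exact hp.2.2.2.2 e he hv

theorem IsEdgeMatching.eq_of_mem {M : Set (Sym2 V)} (hM : IsEdgeMatching G M) {e f : Sym2 V}
    (he : e ∈ M) (hf : f ∈ M) {x : V} (hxe : x ∈ e) (hxf : x ∈ f) : e = f := by
  by_contra h
  exact hM.2 e he f hf h x ⟨hxe, hxf⟩

theorem IsEdgeMatching.subset {M N : Set (Sym2 V)} (hM : IsEdgeMatching G M) (h : N ⊆ M) :
    IsEdgeMatching G N :=
  ⟨h.trans hM.1, fun e he f hf => hM.2 e (h he) f (h hf)⟩

theorem IsEdgeMatching.insert_edge {M : Set (Sym2 V)} (hM : IsEdgeMatching G M) {u w : V}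
    (h : G.Adj u w) (hu : EdgeFree M u) (hw : EdgeFree M w) :
    IsEdgeMatching G (insert s(u, w) M) := by
  have key : ∀ f ∈ M, ∀ x, x ∈ s(u, w) → x ∉ f := by
    intro f hf x hx
    rcases Sym2.mem_iff.1 hx with rfl | rfl
    · exact hu f hf
    · exact hw f hf
  refine ⟨Set.insert_subset h hM.1, ?_⟩
  rintro e (rfl | he) f (rfl | hf) hef x ⟨hx, hx'⟩
  · exact hef rfl
  · exact key f hf x hx hx'
  · exact key e he x hx' hx
  · exact hM.2 e he f hf hef x ⟨hx, hx'⟩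

/-- Flipping a matching along an alternating path that starts at a free vertex. -/
theorem IsEdgeMatching.symmDiff_altWalk [Finite V] : ∀ {M : Set (Sym2 V)} {u v : V}
    {p : G.Walk u v}, IsEdgeMatching G M → p.IsPath → AltWalk Mᶜ M p → EdgeFree M u →
    (Odd p.length → EdgeFree M v) →
    IsEdgeMatching G (symmDiff M {e | e ∈ p.edges}) ∧
      (symmDiff M {e | e ∈ p.edges}).ncard = M.ncard + p.length % 2
  | M, _, _, .nil, hM, _, _, _, _ => by
    have : symmDiff M {e | e ∈ ([] : List (Sym2 V))} = M := by
      ext e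
      simp [Set.mem_symmDiff]
    simp only [SimpleGraph.Walk.edges_nil, this]
    exact ⟨hM, by simp⟩
  | M, u, v, .cons h .nil, hM, _, hp, hu, hv => by
    have h1 : s(u, v) ∉ M := hp.1
    have : symmDiff M {e | e ∈ (SimpleGraph.Walk.cons h .nil : G.Walk u v).edges} =
        insert s(u, v) M := by
      ext e
      simp only [SimpleGraph.Walk.edges_cons, SimpleGraph.Walk.edges_nil, Set.mem_symmDiff,
        Set.mem_ofPred_eq, List.mem_singleton, Set.mem_insert_iff]
      grind
    rw [this]
    exact ⟨hM.insert_edge h hu (hv (by simp)), by simp [Set.ncard_insert_of_notMem h1]⟩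
  | M, u, v, .cons (v := w) h (.cons (v := x) h' p), hM, hpath, hp, hu, hv => by
    have h1 : s(u, w) ∉ M := hp.1
    have h2 : s(w, x) ∈ M := hp.2.1
    have hpp : p.IsPath := hpath.of_cons.of_cons
    have hw : w ∉ p.support := (SimpleGraph.Walk.cons_isPath_iff _ _).1 hpath.of_cons |>.2
    have hu' : u ∉ p.support := by
      have := (SimpleGraph.Walk.cons_isPath_iff _ _).1 hpath |>.2
      simp only [SimpleGraph.Walk.support_cons, List.mem_cons, not_or] at this
      exact this.2
    have h3 : s(w, x) ∉ p.edges := fun hc => hw (p.fst_mem_support_of_mem_edges hc)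
    have h4 : s(u, w) ∉ p.edges := fun hc => hu' (p.fst_mem_support_of_mem_edges hc)
    have hux : u ≠ x := fun hc => hu' (hc ▸ p.start_mem_support)
    have huv : u ≠ v := fun hc => hu' (hc ▸ p.end_mem_support)
    have hwv : w ≠ v := fun hc => hw (hc ▸ p.end_mem_support)
    have hne : s(u, w) ≠ s(w, x) := fun hc => h1 (hc ▸ h2)
    have hM' : IsEdgeMatching G (insert s(u, w) (M \ {s(w, x)})) := by
      refine (hM.subset Set.sdiff_subset).insert_edge h (fun e he => hu e he.1) ?_
      rintro e ⟨he, hne⟩ hwe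
      exact hne (hM.eq_of_mem he h2 hwe (by simp))
    have hx : EdgeFree (insert s(u, w) (M \ {s(w, x)})) x := by
      rintro e (rfl | ⟨he, hne⟩) hxe
      · rcases Sym2.mem_iff.1 hxe with rfl | rfl
        · exact hux rfl
        · exact h'.ne rfl
      · exact hne (hM.eq_of_mem he h2 hxe (by simp))
    have hv' : Odd p.length → EdgeFree (insert s(u, w) (M \ {s(w, x)})) v := by
      rintro ho e (rfl | ⟨he, hne⟩) hve
      · rcases Sym2.mem_iff.1 hve with rfl | rfl
        · exact huv rfl
        · exact hwv rfl
      · exact hv (by simpa [Nat.odd_add_one] using ho) e he hve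
    have halt : AltWalk (insert s(u, w) (M \ {s(w, x)}))ᶜ (insert s(u, w) (M \ {s(w, x)})) p := by
      refine hp.2.2.mono_on (fun e he heM => ?_) (fun e he heM => ?_)
      · rintro (rfl | h)
        · exact h4 he
        · exact heM h.1
      · exact Or.inr ⟨heM, fun hc => h3 (hc ▸ he)⟩
    have ih := hM'.symmDiff_altWalk hpp halt hx hv'
    have heq : symmDiff M {e | e ∈ (SimpleGraph.Walk.cons h (.cons h' p)).edges} =
        symmDiff (insert s(u, w) (M \ {s(w, x)})) {e | e ∈ p.edges} := by
      ext e
      simp only [SimpleGraph.Walk.edges_cons, Set.mem_symmDiff, Set.mem_insert_iff, Set.mem_sdiff,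
        Set.mem_ofPred_eq, List.mem_cons, Set.mem_singleton_iff]
      grind
    have hcard : (insert s(u, w) (M \ {s(w, x)})).ncard = M.ncard := by
      rw [Set.ncard_insert_of_notMem (by simp [h1]), Set.ncard_sdiff_singleton_add_one h2]
    rw [heq]
    refine ⟨ih.1, ?_⟩
    rw [ih.2, hcard]
    simp only [SimpleGraph.Walk.length_cons]
    omega

/-- A maximal path alternating between `N` and `M` from an `M`-free vertex. -/
theorem exists_maximal_altWalk [Finite V] : ∀ (n : ℕ) {M N : Set (Sym2 V)},
    IsEdgeMatching G M → IsEdgeMatching G N → N.ncard = n → ∀ u, EdgeFree M u →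
    ∃ (v : V) (p : G.Walk u v), p.IsPath ∧ AltWalk (N \ M) (M \ N) p ∧
      (Even p.length → EdgeFree N v) ∧ (Odd p.length → EdgeFree M v) := by
  intro n
  induction n with
  | zero =>
    intro M N _ _ hn u hu
    rw [Set.ncard_eq_zero] at hn
    exact ⟨u, .nil, by simp, trivial, by simp [hn, EdgeFree], by simp⟩
  | succ n ih =>
    intro M N hM hN hn u hu
    by_cases huN : EdgeFree N u
    · exact ⟨u, .nil, by simp, trivial, fun _ => huN, by simp⟩
    simp only [EdgeFree, not_forall, not_not] at huN
    obtain ⟨e, he, hue⟩ := huN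
    obtain ⟨w, rfl⟩ := hue
    have h1 : s(u, w) ∉ M := fun hc => hu _ hc (by simp)
    have huw : G.Adj u w := hN.1 he
    by_cases hwM : EdgeFree M w
    · exact ⟨w, .cons huw .nil, by simp [huw.ne], ⟨⟨he, h1⟩, trivial⟩, by simp, fun _ => hwM⟩
    simp only [EdgeFree, not_forall, not_not] at hwM
    obtain ⟨f, hf, hwf⟩ := hwM
    obtain ⟨x, rfl⟩ := hwf
    have hwx : G.Adj w x := hM.1 hf
    have hxu : x ≠ u := by
      rintro rfl
      exact hu _ hf (by simp)
    have h2 : s(w, x) ∉ N := by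
      intro hc
      have := hN.eq_of_mem hc he (x := w) (by simp) (by simp)
      exact h1 (this ▸ hf)
    have hM' : IsEdgeMatching G (M \ {s(w, x)}) := hM.subset Set.sdiff_subset
    have hN' : IsEdgeMatching G (N \ {s(u, w)}) := hN.subset Set.sdiff_subset
    have hx : EdgeFree (M \ {s(w, x)}) x := fun e he hxe =>
      he.2 (hM.eq_of_mem he.1 hf hxe (by simp))
    have hwM : EdgeFree (M \ {s(w, x)}) w := fun e he hxe =>
      he.2 (hM.eq_of_mem he.1 hf hxe (by simp))
    have hwN : EdgeFree (N \ {s(u, w)}) w := fun g hg hxe =>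
      hg.2 (hN.eq_of_mem hg.1 he hxe (by simp))
    have huN : EdgeFree (N \ {s(u, w)}) u := fun g hg hxe =>
      hg.2 (hN.eq_of_mem hg.1 he hxe (by simp))
    obtain ⟨v, p, hp, halt, heven, hodd⟩ := ih hM' hN'
      (by rw [Set.ncard_sdiff_singleton_of_mem he, hn, Nat.add_sub_cancel]) x hx
    have hsupp : ∀ y, y ≠ x → EdgeFree (M \ {s(w, x)}) y → EdgeFree (N \ {s(u, w)}) y →
        y ∉ p.support := by
      intro y hyx hyM hyN hy
      rcases halt.exists_mem_of_mem_support y hy with ⟨rfl, hl⟩ | ⟨e, -, he, hye⟩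
      · obtain ⟨e, he, hye⟩ := halt.exists_mem_end hl hyx.symm
        exact hyM e he.1 hye
      · exact hyN e he.1 hye
    have hup : u ∉ p.support := hsupp u hxu.symm (fun e he => hu e he.1) huN
    have hwp : w ∉ p.support := hsupp w hwx.ne hwM hwN
    refine ⟨v, .cons huw (.cons hwx p), ?_, ⟨⟨he, h1⟩, ⟨hf, h2⟩, halt.mono ?_ ?_⟩, ?_, ?_⟩
    · simp [hp, hup, hwp, huw.ne]
    · rintro e ⟨⟨he, -⟩, heM⟩
      exact ⟨he, fun hc => heM ⟨hc, fun h => h2 (h ▸ he)⟩⟩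
    · rintro e ⟨⟨he, -⟩, heN⟩
      exact ⟨he, fun hc => heN ⟨hc, fun h => h1 (h ▸ he)⟩⟩
    · intro hl e' he' hve
      refine heven (by simpa [Nat.even_add_one] using hl) e' ⟨he', ?_⟩ hve
      rintro rfl
      rcases Sym2.mem_iff.1 hve with rfl | rfl
      · exact hup p.end_mem_support
      · exact hwp p.end_mem_support
    · intro hl e' he' hve
      have hl' : Odd p.length := by simpa [Nat.odd_add_one] using hl
      refine hodd hl' e' ⟨he', ?_⟩ hve
      rintro rfl
      rcases Sym2.mem_iff.1 hve with rfl | rfl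
      · exact hwp p.end_mem_support
      · rw [SimpleGraph.Walk.isPath_iff_nil, ← SimpleGraph.Walk.length_eq_zero_iff] at hp
        simp [hp] at hl'

theorem IsEdgeMatching.ncard_covered [Finite V] {M : Set (Sym2 V)} (hM : IsEdgeMatching G M) :
    {x | ∃ e ∈ M, x ∈ e}.ncard = 2 * M.ncard := by
  classical
  have := Fintype.ofFinite V
  have hfin : M.Finite := M.toFinite
  have : {x | ∃ e ∈ M, x ∈ e} = (hfin.toFinset.biUnion Sym2.toFinset : Set V) := by
    ext x
    simp
  rw [this, Set.ncard_coe_finset, Finset.card_biUnion, Finset.sum_const_nat (m := 2),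
    Set.ncard_eq_toFinset_card M hfin, mul_comm]
  · intro e he
    exact Sym2.card_toFinset_of_not_isDiag e
      (G.not_isDiag_of_mem_edgeSet (hM.1 (by simpa using he)))
  · intro e he f hf hef
    rw [Function.onFun, Finset.disjoint_left]
    intro x hx hx'
    exact hM.2 e (by simpa using he) f (by simpa using hf) hef x
      ⟨Sym2.mem_toFinset.1 hx, Sym2.mem_toFinset.1 hx'⟩

theorem IsEdgeMatching.exists_free_not_free [Finite V] {M N : Set (Sym2 V)}
    (hM : IsEdgeMatching G M) (hN : IsEdgeMatching G N) (h : M.ncard < N.ncard) :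
    ∃ u, EdgeFree M u ∧ ¬ EdgeFree N u := by
  by_contra! hc
  have hsub : {x | ∃ e ∈ N, x ∈ e} ⊆ {x | ∃ e ∈ M, x ∈ e} := by
    rintro x ⟨e, he, hx⟩
    by_contra hx'
    refine hc x (fun f hf hxf => hx' ⟨f, hf, hxf⟩) e he hx
  have := Set.ncard_le_ncard hsub
  rw [hM.ncard_covered, hN.ncard_covered] at this
  omega

/-- If all `M`-augmenting paths have length at least `2 * m + 1`, then `M \ N` has at least
`m * (|N| - |M|)` elements. -/
theorem IsEdgeMatching.mul_ncard_le [Finite V] {M : Set (Sym2 V)} (hM : IsEdgeMatching G M)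
    {m : ℕ} (hlen : ∀ {u v : V} (p : G.Walk u v), IsAugPath M p → 2 * m + 1 ≤ p.length) :
    ∀ (n : ℕ) {N : Set (Sym2 V)}, IsEdgeMatching G N → (N \ M).ncard = n →
      m * N.ncard ≤ m * M.ncard + (M \ N).ncard := by
  intro n
  induction n using Nat.strong_induction_on with
  | _ n ih =>
    intro N hN hn
    rcases le_or_gt N.ncard M.ncard with hle | hlt
    · exact (Nat.mul_le_mul_left m hle).trans (Nat.le_add_right _ _)
    obtain ⟨u, huM, huN⟩ := hM.exists_free_not_free hN hlt
    obtain ⟨v, p, hp, halt, heven, hodd⟩ := exists_maximal_altWalk _ hM hN rfl u huM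
    have haltM : AltWalk Mᶜ M p := halt.mono (fun _ h => h.2) (fun _ h => h.1)
    have hedge : ∀ e ∈ p.edges, e ∈ N \ M ∨ e ∈ M \ N := by
      clear * - halt
      generalize N \ M = A at *
      generalize M \ N = B at *
      induction p generalizing A B with
      | nil => simp
      | cons h q ihq =>
        intro e he
        rw [SimpleGraph.Walk.edges_cons, List.mem_cons] at he
        rcases he with rfl | he
        · exact Or.inl halt.1
        · exact (ihq _ _ halt.2 e he).symm
    cases p with
    | nil => exact absurd (heven (by simp)) huN
    | @cons _ w _ h q =>
      have h1 : s(u, w) ∈ N \ M := halt.1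
      have hu : u ∉ q.support := ((SimpleGraph.Walk.cons_isPath_iff _ _).1 hp).2
      have hq : q.IsPath := hp.of_cons
      have huq : s(u, w) ∉ q.edges := fun hc => hu (q.fst_mem_support_of_mem_edges hc)
      have hN0 : IsEdgeMatching G (N \ {s(u, w)}) := hN.subset Set.sdiff_subset
      have hflip := hN0.symmDiff_altWalk hq
        (halt.2.mono_on (fun e _ h hc => h.2 hc.1)
          (fun e he h => ⟨h.1, fun hc => huq (hc ▸ he)⟩))
        (fun e he hw => he.2 (hN.eq_of_mem he.1 h1.1 hw (by simp)))
        (fun ho e he => heven (by simpa [Nat.even_add_one] using ho) e he.1)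
      have heq : symmDiff (N \ {s(u, w)}) {e | e ∈ q.edges} =
          symmDiff N {e | e ∈ (SimpleGraph.Walk.cons h q).edges} := by
        ext e
        simp only [SimpleGraph.Walk.edges_cons, Set.mem_symmDiff, Set.mem_sdiff,
          Set.mem_ofPred_eq, List.mem_cons, Set.mem_singleton_iff]
        grind
      have hcount := haltM.ncard_inter hp
      rw [heq, Set.ncard_sdiff_singleton_of_mem h1.1] at hflip
      have hmem : s(u, w) ∈ (SimpleGraph.Walk.cons h q).edges := by simp
      have hpar : (SimpleGraph.Walk.cons h q).length = q.length + 1 := rfl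
      have haug : Odd (SimpleGraph.Walk.cons h q).length →
          IsAugPath M (SimpleGraph.Walk.cons h q) := fun ho =>
        ⟨hp, fun hc => hu (hc ▸ q.end_mem_support),
          haltM.isChain (Or.inl ⟨subset_rfl, subset_rfl⟩), huM, hodd ho⟩
      generalize SimpleGraph.Walk.cons h q = p at *
      set N' := symmDiff N {e | e ∈ p.edges} with hN'
      have hlt' : (N' \ M).ncard < n := by
        rw [← hn]
        refine Set.ncard_lt_ncard ⟨?_, fun hc => ?_⟩
        · rintro e ⟨he, heM⟩
          rw [hN', Set.mem_symmDiff] at he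
          rcases he with he | he
          · exact ⟨he.1, heM⟩
          · have := hedge e he.1
            grind
        · have := (hc h1).1
          rw [hN', Set.mem_symmDiff] at this
          exact this.elim (fun h => h.2 hmem) (fun h => h.2 h1.1)
      have key := ih _ hlt' hflip.1 rfl
      have hsum : (M \ N').ncard + (M ∩ {e | e ∈ p.edges}).ncard = (M \ N).ncard := by
        rw [← Set.ncard_union_eq]
        · congr 1
          ext e
          have := hedge e
          simp only [hN', Set.mem_union, Set.mem_sdiff, Set.mem_symmDiff, Set.mem_inter_iff,
            Set.mem_ofPred_eq]
          grind
        · rw [Set.disjoint_left]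
          rintro e he ⟨heM, hep⟩
          have := hedge e hep
          have h' := he.2
          rw [hN', Set.mem_symmDiff] at h'
          grind
      have hpos : 0 < N.ncard := by omega
      rcases Nat.even_or_odd p.length with hE | hO
      · have : N'.ncard = N.ncard := by
          have := hflip.2
          obtain ⟨r, hr⟩ := hE
          omega
        rw [this] at key
        omega
      · have h2 := hlen p (haug hO)
        have : N.ncard = N'.ncard + 1 := by
          have := hflip.2
          obtain ⟨r, hr⟩ := hO
          omega
        rw [this, mul_add, mul_one]
        omega

theorem exists_mem_support_of_mem_pathsEdges {P : Set (PathSig G)} {e : Sym2 V}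
    (he : e ∈ pathsEdges P) {x : V} (hx : x ∈ e) : ∃ p ∈ P, x ∈ p.2.2.support := by
  obtain ⟨p, hp, hep⟩ := he
  exact ⟨p, hp, p.2.2.mem_support_of_mem_edges hep hx⟩

theorem IsAugPath.symmDiff_of_disjoint {M E : Set (Sym2 V)} {u v : V} {q : G.Walk u v}
    (hq : IsAugPath M q) (hE : ∀ e ∈ E, ∀ x ∈ e, x ∉ q.support) :
    IsAugPath (symmDiff M E) q := by
  have hmem : ∀ e ∈ q.edges, e ∉ E := by
    intro e he heE
    induction e with
    | _ a b => exact hE _ heE a (by simp) (q.fst_mem_support_of_mem_edges he)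
  have halt : AltWalk (symmDiff M E)ᶜ (symmDiff M E) q := by
    refine hq.altWalk.mono_on (fun e he h => ?_) (fun e he h => Or.inl ⟨h, hmem e he⟩)
    rintro (hc | hc)
    · exact h hc.1
    · exact hmem e he hc.1
  refine ⟨hq.1, hq.2.1, halt.isChain (Or.inl ⟨subset_rfl, subset_rfl⟩), ?_, ?_⟩
  · rintro e (he | he) hx
    · exact hq.2.2.2.1 e he.1 hx
    · exact hE e he.1 _ hx q.start_mem_support
  · rintro e (he | he) hx
    · exact hq.2.2.2.2 e he.1 hx
    · exact hE e he.1 _ hx q.end_mem_support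

/-- Flipping a matching along vertex-disjoint augmenting paths of length `2 * i + 1`. -/
theorem IsEdgeMatching.symmDiff_pathsEdges [Finite V] {M : Set (Sym2 V)}
    (hM : IsEdgeMatching G M) {i : ℕ} {P : Set (PathSig G)} (hfin : P.Finite)
    (haug : ∀ p ∈ P, IsAugPath M p.2.2 ∧ p.2.2.length = 2 * i + 1)
    (hdisj : ∀ p ∈ P, ∀ q ∈ P, p ≠ q → VDisj p q) :
    IsEdgeMatching G (symmDiff M (pathsEdges P)) ∧
      (symmDiff M (pathsEdges P)).ncard = M.ncard + P.ncard ∧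
      (M ∩ pathsEdges P).ncard ≤ i * P.ncard := by
  induction P, hfin using Set.Finite.induction_on with
  | empty =>
    have h1 : pathsEdges (∅ : Set (PathSig G)) = ∅ := by
      ext e
      simp [pathsEdges]
    have h2 : symmDiff M ∅ = M := symmDiff_bot M
    simp [h1, h2, hM]
  | @insert p P hpP hfin ih =>
    obtain ⟨ih1, ih2, ih3⟩ := ih (fun q hq => haug q (Or.inr hq))
      (fun q hq r hr => hdisj q (Or.inr hq) r (Or.inr hr))
    obtain ⟨hp, hlen⟩ := haug p (Or.inl rfl)
    have hE : ∀ e ∈ pathsEdges P, ∀ x ∈ e, x ∉ p.2.2.support := by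
      intro e he x hx
      obtain ⟨q, hq, hxq⟩ := exists_mem_support_of_mem_pathsEdges he hx
      exact hdisj q (Or.inr hq) p (Or.inl rfl) (fun h => hpP (h ▸ hq)) x hxq
    have hp' := hp.symmDiff_of_disjoint hE
    have hflip := ih1.symmDiff_altWalk hp'.1 hp'.altWalk hp'.2.2.2.1 (fun _ => hp'.2.2.2.2)
    have hunion : pathsEdges (insert p P) = {e | e ∈ p.2.2.edges} ∪ pathsEdges P := by
      ext e
      simp [pathsEdges]
    have hdis : ∀ e ∈ p.2.2.edges, e ∉ pathsEdges P := by
      intro e he heP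
      induction e with
      | _ a b => exact hE _ heP a (by simp) (p.2.2.fst_mem_support_of_mem_edges he)
    have heq : symmDiff M (pathsEdges (insert p P)) =
        symmDiff (symmDiff M (pathsEdges P)) {e | e ∈ p.2.2.edges} := by
      ext e
      have := hdis e
      simp only [hunion, Set.mem_symmDiff, Set.mem_union, Set.mem_ofPred_eq]
      tauto
    have hcount := hp.altWalk.ncard_inter hp.1
    rw [heq, Set.ncard_insert_of_notMem hpP hfin, hunion, Set.inter_union_distrib_left]
    refine ⟨hflip.1, ?_, (Set.ncard_union_le _ _).trans ?_⟩
    · rw [hflip.2, ih2, hlen]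
      omega
    · rw [hcount, hlen, mul_add]
      omega

/-- Augmenting along a maximal set of vertex-disjoint shortest augmenting paths strictly
increases the length of a shortest augmenting path. -/
theorem IsEdgeMatching.length_augPath_symmDiff [Finite V] {M : Set (Sym2 V)}
    (hM : IsEdgeMatching G M) {i : ℕ}
    (hlen : ∀ {u v : V} (p : G.Walk u v), IsAugPath M p → 2 * i + 1 ≤ p.length)
    {P : Set (PathSig G)}
    (haug : ∀ p ∈ P, IsAugPath M p.2.2 ∧ p.2.2.length = 2 * i + 1)
    (hdisj : ∀ p ∈ P, ∀ q ∈ P, p ≠ q → VDisj p q)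
    (hmax : ∀ q : PathSig G, IsAugPath M q.2.2 → q.2.2.length = 2 * i + 1 → q ∉ P →
      ∃ p ∈ P, ¬ VDisj q p) :
    IsEdgeMatching G (symmDiff M (pathsEdges P)) ∧
      ∀ {u v : V} (q : G.Walk u v), IsAugPath (symmDiff M (pathsEdges P)) q →
        2 * (i + 1) + 1 ≤ q.length := by
  have hfin : P.Finite := by
    refine Set.Finite.of_finite_image (f := Sigma.fst) (Set.toFinite _) ?_
    intro p hp q hq hpq
    by_contra hne
    refine hdisj p hp q hq hne p.1 p.2.2.start_mem_support ?_
    have hpq : p.1 = q.1 := hpq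
    rw [hpq]
    exact q.2.2.start_mem_support
  obtain ⟨hM', hcard, hcount⟩ := hM.symmDiff_pathsEdges hfin haug hdisj
  refine ⟨hM', fun {u v} q hq => ?_⟩
  set E := pathsEdges P with hEdef
  by_cases hd : ∀ e ∈ E, ∀ x ∈ e, x ∉ q.support
  · have hqM : IsAugPath M q := by
      have := hq.symmDiff_of_disjoint hd
      rwa [symmDiff_symmDiff_cancel_right] at this
    have hPd : ∀ p ∈ P, VDisj ⟨u, v, q⟩ p := by
      intro p hp x hxq hxp
      obtain ⟨hpa, hpl⟩ := haug p hp
      rcases hpa.altWalk.exists_mem_of_mem_support x hxp with ⟨-, h⟩ | ⟨e, he, -, hxe⟩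
      · exact absurd hpa.odd_length (Nat.not_odd_iff_even.2 h)
      · exact hd e ⟨p, hp, he⟩ x hxe hxq
    have hle := hlen q hqM
    have hne : q.length ≠ 2 * i + 1 := by
      intro hl
      by_cases hqP : (⟨u, v, q⟩ : PathSig G) ∈ P
      · exact hPd _ hqP u q.start_mem_support q.start_mem_support
      · obtain ⟨p, hp, hnd⟩ := hmax ⟨u, v, q⟩ hqM hl hqP
        exact hnd (hPd p hp)
    obtain ⟨r, hr⟩ := hq.odd_length
    omega
  · push Not at hd
    obtain ⟨e₀, ⟨p, hp, he₀⟩, x, hxe₀, hxq⟩ := hd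
    have hxp : x ∈ p.2.2.support := p.2.2.mem_support_of_mem_edges he₀ hxe₀
    have hpa := (haug p hp).1
    obtain ⟨e, he, heM, hxe⟩ : ∃ e ∈ p.2.2.edges, e ∈ Mᶜ ∧ x ∈ e := by
      rcases hpa.altWalk.exists_mem_of_mem_support x hxp with ⟨-, h⟩ | h
      · exact absurd hpa.odd_length (Nat.not_odd_iff_even.2 h)
      · exact h
    have heE : e ∈ E := ⟨p, hp, he⟩
    have heM' : e ∈ symmDiff M E := Or.inr ⟨heE, heM⟩
    have heq : e ∈ q.edges := by
      have halt := hq.altWalk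
      have hu := hq.2.2.2.1
      have hv := hq.2.2.2.2
      cases q with
      | nil => exact absurd rfl hq.2.1
      | cons h r =>
        rw [SimpleGraph.Walk.support_cons, List.mem_cons] at hxq
        rcases hxq with rfl | hxr
        · exact absurd hxe (hu e heM')
        · rcases halt.2.exists_mem_of_mem_support x hxr with ⟨rfl, -⟩ | ⟨f, hf, hfM, hxf⟩
          · exact absurd hxe (hv e heM')
          · rw [hM'.eq_of_mem heM' hfM hxe hxf, SimpleGraph.Walk.edges_cons]
            exact List.mem_cons_of_mem _ hf
    have hflip := hM'.symmDiff_altWalk hq.1 hq.altWalk hq.2.2.2.1 (fun _ => hq.2.2.2.2)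
    have hqcount := hq.altWalk.ncard_inter hq.1
    have key := hM.mul_ncard_le hlen _ hflip.1 rfl
    set Q : Set (Sym2 V) := {e | e ∈ q.edges}
    have hdiff : (M \ symmDiff (symmDiff M E) Q).ncard ≤
        (M ∩ E).ncard + ((M ∩ Q) \ E).ncard := by
      refine le_trans (Set.ncard_le_ncard ?_) (Set.ncard_union_le _ _)
      intro f
      simp only [Set.mem_sdiff, Set.mem_symmDiff, Set.mem_union, Set.mem_inter_iff]
      tauto
    have hlt : ((M ∩ Q) \ E).ncard < (symmDiff M E ∩ Q).ncard := by
      refine Set.ncard_lt_ncard ⟨?_, fun hc => heM (hc ⟨heM', heq⟩).1.1⟩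
      intro f
      simp only [Set.mem_sdiff, Set.mem_symmDiff, Set.mem_inter_iff]
      tauto
    obtain ⟨r, hr⟩ := hq.odd_length
    have hone : q.length % 2 = 1 := by omega
    rw [hflip.2, hcard, hone, mul_add, mul_add, mul_one] at key
    omega

end

/-- **Correctness of the global algorithm (Global-APX-MCM).** Let `0 < ε < 1` and
`k = ⌈1/ε⌉`. Let `M 0 = ∅` and, for `0 ≤ i ≤ k`, let `Pstar (i+1)` be any maximal
collection of pairwise vertex-disjoint `M i`-augmenting paths of length `2i+1`, and
set `M (i+1) = M i ⊕ E(Pstar (i+1))`. Then `M (k+1)` is a matching in `G` with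
`|M (k+1)| ≥ (1 − ε)·|Mstar|`, where `Mstar` is a maximum cardinality matching. -/
theorem global_apx_mcm {V : Type*} [Fintype V] [DecidableEq V]
    (G : SimpleGraph V) (ε : ℝ) (hε0 : 0 < ε) (hε1 : ε < 1)
    (k : ℕ) (hk : k = ⌈1 / ε⌉₊)
    (M : ℕ → Set (Sym2 V)) (Pstar : ℕ → Set (PathSig G))
    (hM0 : M 0 = ∅)
    (hPaug : ∀ i ≤ k, ∀ p ∈ Pstar (i + 1),
        IsAugPath (M i) p.2.2 ∧ p.2.2.length = 2 * i + 1)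
    (hPdisj : ∀ i ≤ k, ∀ p ∈ Pstar (i + 1), ∀ q ∈ Pstar (i + 1), p ≠ q → VDisj p q)
    (hPmax : ∀ i ≤ k, ∀ q : PathSig G, IsAugPath (M i) q.2.2 →
        q.2.2.length = 2 * i + 1 → q ∉ Pstar (i + 1) →
        ∃ p ∈ Pstar (i + 1), ¬ VDisj q p)
    (hMstep : ∀ i ≤ k, M (i + 1) = symmDiff (M i) (pathsEdges (Pstar (i + 1))))
    (Mstar : Set (Sym2 V)) (hMstar : IsEdgeMatching G Mstar)
    (hmax : ∀ M' : Set (Sym2 V), IsEdgeMatching G M' → M'.ncard ≤ Mstar.ncard) :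
    IsEdgeMatching G (M (k + 1)) ∧
      (1 - ε) * (Mstar.ncard : ℝ) ≤ ((M (k + 1)).ncard : ℝ) := by
  have hinv : ∀ i ≤ k + 1, IsEdgeMatching G (M i) ∧
      ∀ {u v : V} (p : G.Walk u v), IsAugPath (M i) p → 2 * i + 1 ≤ p.length := by
    intro i
    induction i with
    | zero =>
      refine fun _ => ⟨by simp [hM0, IsEdgeMatching], fun p hp => ?_⟩
      obtain ⟨r, hr⟩ := hp.odd_length
      omega
    | succ i ih =>
      intro hi
      have hi : i ≤ k := by omega
      obtain ⟨h1, h2⟩ := ih (by omega)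
      rw [hMstep i hi]
      exact h1.length_augPath_symmDiff h2 (hPaug i hi) (hPdisj i hi) (hPmax i hi)
  obtain ⟨hmatch, hlen⟩ := hinv (k + 1) le_rfl
  refine ⟨hmatch, ?_⟩
  have key := hmatch.mul_ncard_le hlen _ hMstar rfl
  have hle : (M (k + 1) \ Mstar).ncard ≤ (M (k + 1)).ncard :=
    Set.ncard_le_ncard Set.sdiff_subset
  have hkey : ((k : ℝ) + 1) * Mstar.ncard ≤ (k + 2) * (M (k + 1)).ncard := by
    have : (k + 1) * Mstar.ncard ≤ (k + 2) * (M (k + 1)).ncard := by linarith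
    exact_mod_cast this
  have hk1 : 1 ≤ ε * k := by
    have : 1 / ε ≤ k := hk ▸ Nat.le_ceil (1 / ε)
    rwa [div_le_iff₀' hε0] at this
  have hstar : (0 : ℝ) ≤ Mstar.ncard := Nat.cast_nonneg _
  have hk2 : (0 : ℝ) < k + 2 := by positivity
  refine le_of_mul_le_mul_left ?_ hk2
  refine le_trans ?_ hkey
  rw [← mul_assoc]
  refine mul_le_mul_of_nonneg_right ?_ hstar
  nlinarith
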